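/- In the setting of the previous statement (U a sum of weight spaces meeting the open orbit, ι the injective map with β_j + α_{ι(j)} ∈ Ψ_U), for any subset J of the weight index set J_V, the element δ₀ + ∑_{j∈J} β_j lies in the cone ℝ_{≥0}(Ψ_U ∪ Δ₀), where δ₀ = ∑_{α ∈ Φ_G^+} (dim g_α)·α is the sum of positive roots with multiplicity and Δ₀ the set of simple roots. In particular, the gauge λ(U) = δ₀ + ∑_{β ∈ Ψ_V \ Ψ_U} (dim V_β)·β lies in ℝ_{≥0}(Ψ_U ∪ Δ₀). -/

import Mathlib

open scoped NNReal in
/-- Membership in the cone spanned by a finite set, in terms of nonnegative real coefficients. -/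
theorem mem_span_nnreal_finset_iff {W : Type*} [AddCommGroup W] [Module ℝ W]
    {S : Finset W} {x : W} :
    x ∈ Submodule.span ℝ≥0 (S : Set W) ↔
      ∃ c : W → ℝ, (∀ w, 0 ≤ c w) ∧ x = ∑ w ∈ S, c w • w := by
  constructor
  · intro hx
    obtain ⟨f, -, hf⟩ := Submodule.mem_span_finset.1 hx
    exact ⟨fun w => f w, fun w => (f w).2, hf.symm⟩
  · rintro ⟨c, hc, rfl⟩
    exact Submodule.sum_mem _ fun w hw =>
      Submodule.smul_mem _ (⟨c w, hc w⟩ : ℝ≥0) (Submodule.subset_span hw)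

/-- If `C` contains `f i` for `i ∈ P` and `-f i` for `i ∉ P`, then it contains the sum of `f`
over `P` minus the sum of `f` over any finite set. -/
theorem sum_sub_sum_mem_of_mem_of_neg_mem {ι W : Type*} [AddCommGroup W] [DecidableEq ι]
    (C : AddSubmonoid W) (f : ι → W) (P K : Finset ι)
    (hpos : ∀ i ∈ P, f i ∈ C) (hneg : ∀ i, i ∉ P → -f i ∈ C) :
    ∑ i ∈ P, f i - ∑ i ∈ K, f i ∈ C := by
  rw [← Finset.sum_sdiff_sub_sum_sdiff, sub_eq_add_neg, ← Finset.sum_neg_distrib]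
  exact C.add_mem (C.sum_mem fun i hi => hpos i (Finset.mem_sdiff.1 hi).1)
    (C.sum_mem fun i hi => hneg i (Finset.mem_sdiff.1 hi).2)

/-- Setting: `W` is the real vector space containing the roots and weights.  `IG` indexes
the multiset of roots of `G` (with multiplicity `dim g_α`; `0` may occur), via `α : IG → W`;
`Ipos ⊆ IG` indexes the positive roots, so that `δ₀ = ∑_{i ∈ Ipos} α i` is the sum of the
positive roots with multiplicity; every index carries a positive root, the negative of a
positive root, or `0` (`hcover`, with `negI` realizing `Φ_G = -Φ_G` at the level of
indices); and every positive root is a nonnegative combination of the simple roots `Δ₀`.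
`JV` indexes the multiset of weights of `V` via `β : JV → W`, and `ΨU` is the weight set of
a subspace `U ∈ Minset(V)`, so that (by the previous statement) there is an injective
`ι : JV → IG` with `β j + α (ι j) ∈ ΨU` for all `j`.  Conclusion: for any subset
`J ⊆ JV`, the element `δ₀ + ∑_{j ∈ J} β j` lies in the cone `ℝ_{≥0}(ΨU ∪ Δ₀)`; in
particular the gauge `λ(U) = δ₀ + ∑_{β ∈ Ψ_V \ Ψ_U} n_β • β = δ₀ + ∑_{j, β j ∉ ΨU} β j`
lies in `ℝ_{≥0}(ΨU ∪ Δ₀)`. -/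
theorem gauge_in_cone {W : Type*} [AddCommGroup W] [Module ℝ W] [DecidableEq W]
    {IG JV : Type*} [Fintype IG] [Fintype JV] [DecidableEq IG] [DecidableEq JV]
    (α : IG → W) (β : JV → W)
    (Ipos : Finset IG) (Δ₀ ΨU : Finset W)
    (negI : IG ≃ IG) (hneg : ∀ i, α (negI i) = -α i)
    (hcover : ∀ i : IG, i ∈ Ipos ∨ negI i ∈ Ipos ∨ α i = 0)
    (hsimple : ∀ i ∈ Ipos, ∃ d : W → ℝ, (∀ w, 0 ≤ d w) ∧ α i = ∑ w ∈ Δ₀, d w • w)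
    (ι : JV → IG) (hinj : Function.Injective ι) (hι : ∀ j, β j + α (ι j) ∈ ΨU) :
    (∀ J : Finset JV, ∃ c : W → ℝ, (∀ w, 0 ≤ c w) ∧
        (∑ i ∈ Ipos, α i) + ∑ j ∈ J, β j = ∑ w ∈ ΨU ∪ Δ₀, c w • w) ∧
      (∃ c : W → ℝ, (∀ w, 0 ≤ c w) ∧
        (∑ i ∈ Ipos, α i) + ∑ j ∈ Finset.univ.filter (fun j : JV => β j ∉ ΨU), β j
          = ∑ w ∈ ΨU ∪ Δ₀, c w • w) := by
  have key : ∀ J : Finset JV, ∃ c : W → ℝ, (∀ w, 0 ≤ c w) ∧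
      (∑ i ∈ Ipos, α i) + ∑ j ∈ J, β j = ∑ w ∈ ΨU ∪ Δ₀, c w • w := by
    intro J
    rw [← mem_span_nnreal_finset_iff]
    set C := Submodule.span NNReal ((ΨU ∪ Δ₀ : Finset W) : Set W) with hC
    have hpos : ∀ i ∈ Ipos, α i ∈ C := fun i hi =>
      Submodule.span_mono (Finset.coe_subset.2 Finset.subset_union_right)
        (mem_span_nnreal_finset_iff.2 (hsimple i hi))
    have hnonpos : ∀ i, i ∉ Ipos → -α i ∈ C := by
      intro i hi
      rcases hcover i with h | h | h
      · exact absurd h hi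
      · exact hneg i ▸ hpos _ h
      · rw [h, neg_zero]
        exact C.zero_mem
    have hroots := sum_sub_sum_mem_of_mem_of_neg_mem C.toAddSubmonoid α Ipos (J.image ι)
      hpos hnonpos
    rw [Finset.sum_image hinj.injOn] at hroots
    have hweights : ∑ j ∈ J, (β j + α (ι j)) ∈ C := C.sum_mem fun j _ =>
      Submodule.subset_span (Finset.mem_coe.2 (Finset.mem_union_left _ (hι j)))
    convert C.add_mem hroots hweights using 1
    rw [Finset.sum_add_distrib]
    abel
  exact ⟨key, key _⟩
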